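/- With E_n defined as the expected size of the automorphism group of a uniformly random graph on n vertices, for all sufficiently large n one has 1 ≤ E_n ≤ 1 + Σ_{m=2}^{n} 2^{-m(n/2 - 3m/8 - 2 log₂ n)} ≤ 1 + 2^{-(n - 4 log₂ n - 2)}. -/

import Mathlib

open scoped Classical

/-- `E_n`: the expected size of the automorphism group of a uniformly random graph
on `n` vertices. -/
noncomputable def autAvg (n : ℕ) : ℝ :=
  (∑ G : SimpleGraph (Fin n),
    (Nat.card {π : Equiv.Perm (Fin n) // ∀ u v, G.Adj (π u) (π v) ↔ G.Adj u v} : ℝ))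
      / 2 ^ n.choose 2

theorem mem_iff_of_sameCycle {α : Type*} [Finite α] {σ : Equiv.Perm α} {s : Set α}
    (hs : ∀ a, σ a ∈ s ↔ a ∈ s) {a b : α} (h : σ.SameCycle a b) : a ∈ s ↔ b ∈ s := by
  obtain ⟨k, rfl⟩ := h.exists_nat_pow_eq
  clear h
  induction k with
  | zero => simp
  | succ k ih => rw [ih, pow_succ', Equiv.Perm.mul_apply, hs]

section InvariantSets

variable {α : Type*} [Fintype α]

/-- An orbit of a permutation is a fixed point or has at least two elements. -/
theorem two_mul_card_cycleQuotient_le [DecidableEq α] (σ : Equiv.Perm α) :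
    2 * Fintype.card (Quotient (Equiv.Perm.SameCycle.setoid σ)) ≤
      Fintype.card α + (Finset.univ.filter fun a => σ a = a).card := by
  let mk : α → Quotient (Equiv.Perm.SameCycle.setoid σ) := Quotient.mk _
  have hα : Fintype.card α = ∑ q, (Finset.univ.filter fun a => mk a = q).card := by
    rw [← Finset.card_univ]
    exact Finset.card_eq_sum_card_fiberwise fun _ _ => Finset.mem_coe.2 (Finset.mem_univ _)
  have hfix : (Finset.univ.filter fun a => σ a = a).card =
      ∑ q, ((Finset.univ.filter fun a => σ a = a).filter fun a => mk a = q).card :=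
    Finset.card_eq_sum_card_fiberwise fun _ _ => Finset.mem_coe.2 (Finset.mem_univ _)
  rw [hα, hfix, ← Finset.sum_add_distrib, mul_comm, ← smul_eq_mul, ← Finset.card_univ,
    ← Finset.sum_const]
  refine Finset.sum_le_sum fun q _ => ?_
  induction q using Quotient.inductionOn with
  | h a =>
    by_cases ha : σ a = a
    · have h₁ : 0 < (Finset.univ.filter fun b => mk b = mk a).card :=
        Finset.card_pos.2 ⟨a, by simp⟩
      have h₂ : 0 < ((Finset.univ.filter fun b => σ b = b).filter fun b => mk b = mk a).card :=
        Finset.card_pos.2 ⟨a, by simp [ha]⟩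
      change 2 ≤ (Finset.univ.filter fun b => mk b = mk a).card + _
      exact Nat.add_le_add h₁ h₂
    · have h₁ : 1 < (Finset.univ.filter fun b => mk b = mk a).card := by
        refine Finset.one_lt_card.2 ⟨σ a, ?_, a, by simp, ha⟩
        have : mk (σ a) = mk a :=
          Quotient.sound (Equiv.Perm.sameCycle_apply_left.2 (Equiv.Perm.SameCycle.refl σ a))
        simp [this]
      exact le_add_right h₁

/-- A permutation preserves at most one set per set of orbits. -/
theorem card_invariantSets_le (σ : Equiv.Perm α) :
    Nat.card {s : Set α // ∀ a, σ a ∈ s ↔ a ∈ s} ≤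
      2 ^ Fintype.card (Quotient (Equiv.Perm.SameCycle.setoid σ)) := by
  rw [← Fintype.card_set, ← Nat.card_eq_fintype_card]
  refine Nat.card_le_card_of_injective
    (fun s => Quotient.mk (Equiv.Perm.SameCycle.setoid σ) '' s.1) ?_
  have key : ∀ s : {s : Set α // ∀ a, σ a ∈ s ↔ a ∈ s}, ∀ a,
      Quotient.mk (Equiv.Perm.SameCycle.setoid σ) a ∈
        Quotient.mk (Equiv.Perm.SameCycle.setoid σ) '' s.1 ↔ a ∈ s.1 := by
    refine fun s a => ⟨?_, Set.mem_image_of_mem _⟩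
    rintro ⟨b, hb, hba⟩
    exact (mem_iff_of_sameCycle s.2 (Quotient.exact hba)).1 hb
  intro s t hst
  ext a
  rw [← key s, ← key t]
  exact iff_of_eq (congrArg (Quotient.mk _ a ∈ ·) hst)

end InvariantSets

section FixedGraphs

variable {V : Type*} [Fintype V] [DecidableEq V]

theorem two_pow_choose_le_card_simpleGraph :
    2 ^ (Fintype.card V).choose 2 ≤ Fintype.card (SimpleGraph V) := by
  rw [← Sym2.card_subtype_not_diag, ← Fintype.card_set]
  refine Fintype.card_le_of_injective
    (fun s : Set {e : Sym2 V // ¬ e.IsDiag} => SimpleGraph.fromEdgeSet (Subtype.val '' s)) ?_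
  intro s t hst
  ext e
  have h := congrArg (fun G => e.1 ∈ SimpleGraph.edgeSet G) hst
  simpa [e.2] using h

/-- The permutation of the pairs of distinct vertices induced by a permutation of the vertices. -/
def offDiagPerm (π : Equiv.Perm V) : Equiv.Perm {e : Sym2 V // ¬ e.IsDiag} where
  toFun e := ⟨e.1.map π, by rw [Sym2.isDiag_map π.injective]; exact e.2⟩
  invFun e := ⟨e.1.map π.symm, by rw [Sym2.isDiag_map π.symm.injective]; exact e.2⟩
  left_inv e := by simp [Sym2.map_map]
  right_inv e := by simp [Sym2.map_map]

theorem card_fixed_offDiagPerm_le (π : Equiv.Perm V) :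
    (Finset.univ.filter fun e => offDiagPerm π e = e).card ≤
      (Fintype.card V - π.support.card).choose 2 + π.support.card := by
  rw [← Finset.card_compl, ← Sym2.card_image_offDiag]
  refine le_trans ?_ (Nat.add_le_add_left
    (Finset.card_image_le (s := π.support) (f := fun a => s(a, π a))) _)
  refine le_trans ?_ (Finset.card_union_le _ _)
  rw [← Finset.card_map (Function.Embedding.subtype _)]
  refine Finset.card_le_card fun e he => ?_
  obtain ⟨⟨e, hd⟩, hfix, rfl⟩ := Finset.mem_map.1 he
  induction e using Sym2.ind with
  | h a b =>
    have he : s(π a, π b) = s(a, b) := congrArg Subtype.val (Finset.mem_filter.1 hfix).2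
    have hab : a ≠ b := by simpa using hd
    rw [Function.Embedding.subtype_apply, Finset.mem_union]
    rcases Sym2.eq_iff.1 he with ⟨ha, hb⟩ | ⟨ha, hb⟩
    · exact Or.inl (Finset.mem_image.2 ⟨(a, b), by simp [ha, hb, hab], rfl⟩)
    · refine Or.inr (Finset.mem_image.2 ⟨a, ?_, by rw [ha]⟩)
      rw [Equiv.Perm.mem_support, ha]
      exact hab.symm

theorem card_fixedGraphs_le (π : Equiv.Perm V) :
    Nat.card {G : SimpleGraph V // ∀ u v, G.Adj (π u) (π v) ↔ G.Adj u v} ≤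
      Nat.card {s : Set {e : Sym2 V // ¬ e.IsDiag} // ∀ e, offDiagPerm π e ∈ s ↔ e ∈ s} := by
  refine Nat.card_le_card_of_injective (fun G => ⟨{e | e.1 ∈ G.1.edgeSet}, ?_⟩) ?_
  · rintro ⟨e, he⟩
    induction e using Sym2.ind with
    | h a b => exact G.2 a b
  · rintro ⟨G, hG⟩ ⟨H, hH⟩ h
    refine Subtype.ext (SimpleGraph.ext ?_)
    funext a b
    by_cases hab : a = b
    · subst hab
      simp
    · exact congrArg
        (fun s => (⟨s(a, b), by simpa using hab⟩ : {e : Sym2 V // ¬ e.IsDiag}) ∈ s.1) h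

/-- The exponent comes from counting pairs of vertices: at most half of the moved pairs survive. -/
theorem card_fixedGraphs_le_two_rpow (π : Equiv.Perm V) :
    (Nat.card {G : SimpleGraph V // ∀ u v, G.Adj (π u) (π v) ↔ G.Adj u v} : ℝ) ≤
      (2 : ℝ) ^ ((((Fintype.card V).choose 2 : ℝ) +
        ((Fintype.card V - π.support.card).choose 2 : ℕ) + π.support.card) / 2) := by
  have h₁ := (card_fixedGraphs_le π).trans (card_invariantSets_le (offDiagPerm π))
  have h₂ := (two_mul_card_cycleQuotient_le (offDiagPerm π)).trans
    (Nat.add_le_add_left (card_fixed_offDiagPerm_le π) _)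
  rw [Sym2.card_subtype_not_diag] at h₂
  set q := Fintype.card (Quotient (Equiv.Perm.SameCycle.setoid (offDiagPerm π)))
  have h₁' : (Nat.card {G : SimpleGraph V // ∀ u v, G.Adj (π u) (π v) ↔ G.Adj u v} : ℝ) ≤
      (2 : ℝ) ^ (q : ℝ) := by
    rw [Real.rpow_natCast]
    exact_mod_cast h₁
  refine h₁'.trans (Real.rpow_le_rpow_of_exponent_le one_le_two ?_)
  have h₂' : (2 * q : ℝ) ≤ ((Fintype.card V).choose 2 : ℝ) +
      (((Fintype.card V - π.support.card).choose 2 : ℕ) + π.support.card) := by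
    exact_mod_cast h₂
  linarith

theorem card_perm_support_eq_le (s : Finset V) :
    (Finset.univ.filter fun π : Equiv.Perm V => π.support = s).card ≤ s.card.factorial := by
  rw [← Fintype.card_coe s, ← Fintype.card_perm,
    Fintype.card_congr (Equiv.Perm.subtypeEquivSubtypePerm (· ∈ s)), Fintype.card_subtype]
  refine Finset.card_le_card fun π hπ => ?_
  rw [Finset.mem_filter] at hπ ⊢
  refine ⟨Finset.mem_univ _, fun a ha => ?_⟩
  rwa [← hπ.2, Equiv.Perm.notMem_support] at ha

theorem card_perm_card_support_eq_le (m : ℕ) :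
    (Finset.univ.filter fun π : Equiv.Perm V => π.support.card = m).card ≤
      Fintype.card V ^ m := by
  calc (Finset.univ.filter fun π : Equiv.Perm V => π.support.card = m).card
      = ∑ s ∈ Finset.univ.powersetCard m, ((Finset.univ.filter fun π : Equiv.Perm V =>
          π.support.card = m).filter fun π => π.support = s).card :=
        Finset.card_eq_sum_card_fiberwise fun π hπ => by simpa using hπ
    _ ≤ ∑ s ∈ (Finset.univ : Finset V).powersetCard m, m.factorial := by
        refine Finset.sum_le_sum fun s hs => ?_
        rw [← (Finset.mem_powersetCard.1 hs).2]
        exact (Finset.card_le_card (Finset.filter_subset_filter _ (Finset.filter_subset _ _))).trans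
          (card_perm_support_eq_le s)
    _ = (Fintype.card V).descFactorial m := by
        rw [Finset.sum_const, Finset.card_powersetCard, Finset.card_univ, smul_eq_mul, mul_comm,
          Nat.descFactorial_eq_factorial_mul_choose]
    _ ≤ Fintype.card V ^ m := Nat.descFactorial_le_pow _ _

theorem sum_card_automorphisms_eq :
    ∑ G : SimpleGraph V,
        (Nat.card {π : Equiv.Perm V // ∀ u v, G.Adj (π u) (π v) ↔ G.Adj u v} : ℝ) =
      ∑ π : Equiv.Perm V,
        (Nat.card {G : SimpleGraph V // ∀ u v, G.Adj (π u) (π v) ↔ G.Adj u v} : ℝ) := by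
  simp only [Nat.card_eq_fintype_card, Fintype.card_subtype, Finset.card_filter, Nat.cast_sum]
  exact Finset.sum_comm

end FixedGraphs

theorem one_le_autAvg (n : ℕ) : 1 ≤ autAvg n := by
  rw [autAvg, le_div_iff₀ (by positivity), one_mul]
  have hcard : (2 : ℝ) ^ n.choose 2 ≤ Fintype.card (SimpleGraph (Fin n)) := by
    have := two_pow_choose_le_card_simpleGraph (V := Fin n)
    rw [Fintype.card_fin] at this
    exact_mod_cast this
  refine hcard.trans ?_
  rw [← Finset.card_univ, Finset.cast_card]
  refine Finset.sum_le_sum fun G _ => ?_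
  have : Nonempty {π : Equiv.Perm (Fin n) // ∀ u v, G.Adj (π u) (π v) ↔ G.Adj u v} :=
    ⟨⟨1, fun _ _ => Iff.rfl⟩⟩
  exact_mod_cast Nat.one_le_iff_ne_zero.2 Nat.card_pos.ne'

theorem pow_mul_two_rpow_le {n m : ℕ} (hn : 2 ≤ n) (hmn : m ≤ n) :
    (n : ℝ) ^ m * (2 : ℝ) ^ (((n.choose 2 : ℝ) + ((n - m).choose 2 : ℕ) + m) / 2) ≤
      (2 : ℝ) ^ (-(m : ℝ) * ((n : ℝ) / 2 - 3 * (m : ℝ) / 8 - 2 * Real.logb 2 n)) *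
        2 ^ n.choose 2 := by
  have hn0 : (0 : ℝ) < n := by positivity
  have hlog : 1 ≤ Real.logb 2 n := by
    rw [Real.le_logb_iff_rpow_le one_lt_two hn0]
    simpa using (Nat.cast_le (α := ℝ)).2 hn
  have hpow : (n : ℝ) ^ m = (2 : ℝ) ^ (Real.logb 2 n * m) := by
    rw [Real.rpow_mul zero_le_two, Real.rpow_logb zero_lt_two (by norm_num) hn0,
      Real.rpow_natCast]
  rw [hpow, ← Real.rpow_natCast 2 (n.choose 2), ← Real.rpow_add zero_lt_two,
    ← Real.rpow_add zero_lt_two]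
  refine Real.rpow_le_rpow_of_exponent_le one_le_two ?_
  rw [Nat.cast_choose_two, Nat.cast_choose_two, Nat.cast_sub hmn]
  have hm : (0 : ℝ) ≤ m := m.cast_nonneg
  nlinarith [mul_nonneg hm (sub_nonneg.2 hlog), mul_nonneg hm hm]

theorem autAvg_le {n : ℕ} (hn : 2 ≤ n) :
    autAvg n ≤ 1 + ∑ m ∈ Finset.Icc 2 n,
      (2 : ℝ) ^ (-(m : ℝ) * ((n : ℝ) / 2 - 3 * (m : ℝ) / 8 - 2 * Real.logb 2 n)) := by
  rw [autAvg, div_le_iff₀ (by positivity), sum_card_automorphisms_eq, add_mul, one_mul,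
    Finset.sum_mul]
  have hmaps : ∀ π ∈ (Finset.univ : Finset (Equiv.Perm (Fin n))),
      π.support.card ∈ insert 0 (Finset.Icc 2 n) := by
    intro π _
    have h₁ := π.card_support_ne_one
    have h₂ : π.support.card ≤ n := (Finset.card_le_univ _).trans_eq (Fintype.card_fin n)
    rw [Finset.mem_insert, Finset.mem_Icc]
    omega
  have hfiber : ∀ m, ∑ π : Equiv.Perm (Fin n) with π.support.card = m,
      (Nat.card {G : SimpleGraph (Fin n) // ∀ u v, G.Adj (π u) (π v) ↔ G.Adj u v} : ℝ) ≤
        (n : ℝ) ^ m * (2 : ℝ) ^ (((n.choose 2 : ℝ) + ((n - m).choose 2 : ℕ) + m) / 2) := by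
    intro m
    have hcard := card_perm_card_support_eq_le (V := Fin n) m
    rw [Fintype.card_fin] at hcard
    refine (Finset.sum_le_card_nsmul _ _
      ((2 : ℝ) ^ (((n.choose 2 : ℝ) + ((n - m).choose 2 : ℕ) + m) / 2)) ?_).trans ?_
    · intro π hπ
      have h := card_fixedGraphs_le_two_rpow π
      rwa [(Finset.mem_filter.1 hπ).2, Fintype.card_fin] at h
    · rw [nsmul_eq_mul]
      gcongr
      exact_mod_cast hcard
  rw [← Finset.sum_fiberwise_of_maps_to hmaps, Finset.sum_insert (by simp)]
  refine add_le_add ((hfiber 0).trans_eq ?_) (Finset.sum_le_sum fun m hm =>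
    (hfiber m).trans (pow_mul_two_rpow_le hn (Finset.mem_Icc.1 hm).2))
  rw [← Real.rpow_natCast 2 (n.choose 2)]
  simp

theorem eventually_logb_two_le :
    ∀ᶠ n : ℕ in Filter.atTop, Real.logb 2 n ≤ (n : ℝ) / 100 := by
  have hlog2 : 0 < Real.log 2 := Real.log_pos one_lt_two
  have h := (Real.isLittleO_log_id_atTop.comp_tendsto tendsto_natCast_atTop_atTop).bound
    (c := Real.log 2 / 100) (by positivity)
  filter_upwards [h] with n hn
  have hn' : |Real.log n| ≤ Real.log 2 / 100 * n := by simpa using hn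
  rw [Real.logb, div_le_iff₀ hlog2]
  linarith [le_abs_self (Real.log n)]

/-- The exponent is concave in `m`, so it is controlled by its values at `m = 3` and `m = n`. -/
theorem sub_three_mul_le_of_three_le {n m L : ℝ} (hn : 10 ≤ n) (hL : L ≤ n / 100) (hm : 3 ≤ m)
    (hmn : m ≤ n) : n - 3 * L ≤ m * (n / 2 - 3 * m / 8 - 2 * L) := by
  nlinarith [mul_nonneg (sub_nonneg.2 hm) (sub_nonneg.2 hmn),
    mul_nonneg (sub_nonneg.2 hL) (sub_nonneg.2 hm), mul_nonneg (sub_nonneg.2 hn) (sub_nonneg.2 hm)]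

theorem sum_two_rpow_le {n : ℕ} (hn : 10 ≤ n) (hL : Real.logb 2 n ≤ (n : ℝ) / 100) :
    ∑ m ∈ Finset.Icc 2 n,
        (2 : ℝ) ^ (-(m : ℝ) * ((n : ℝ) / 2 - 3 * (m : ℝ) / 8 - 2 * Real.logb 2 n)) ≤
      (2 : ℝ) ^ (-((n : ℝ) - 4 * Real.logb 2 n - 2)) := by
  have hn0 : (0 : ℝ) < n := by positivity
  set L := Real.logb 2 n with hLdef
  have hnL : (2 : ℝ) ^ L = n := Real.rpow_logb zero_lt_two (by norm_num) hn0
  set A : ℝ := (2 : ℝ) ^ (-((n : ℝ) - 4 * L)) with hA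
  have hA0 : 0 < A := by positivity
  have htail : ∑ m ∈ Finset.Icc 3 n,
      (2 : ℝ) ^ (-(m : ℝ) * ((n : ℝ) / 2 - 3 * (m : ℝ) / 8 - 2 * L)) ≤ A := by
    have hterm : ∀ m ∈ Finset.Icc 3 n,
        (2 : ℝ) ^ (-(m : ℝ) * ((n : ℝ) / 2 - 3 * (m : ℝ) / 8 - 2 * L)) ≤ A / n := by
      intro m hm
      rw [Finset.mem_Icc] at hm
      have := sub_three_mul_le_of_three_le (n := n) (m := m) (by exact_mod_cast hn) hL
        (by exact_mod_cast hm.1) (by exact_mod_cast hm.2)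
      rw [hA, ← hnL, ← Real.rpow_sub zero_lt_two, hnL]
      exact Real.rpow_le_rpow_of_exponent_le one_le_two (by linarith)
    refine (Finset.sum_le_card_nsmul _ _ _ hterm).trans ?_
    rw [Nat.card_Icc, nsmul_eq_mul, mul_div_assoc', div_le_iff₀ hn0, mul_comm]
    gcongr
    omega
  have hhead : (2 : ℝ) ^ (-((2 : ℕ) : ℝ) * ((n : ℝ) / 2 - 3 * ((2 : ℕ) : ℝ) / 8 - 2 * L)) ≤
      3 * A := by
    have hsqrt : (2 : ℝ) ^ (3 / 2 : ℝ) ≤ 3 := by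
      refine le_of_sq_le_sq ?_ (by norm_num)
      rw [← Real.rpow_natCast, ← Real.rpow_mul zero_le_two]
      norm_num
    refine le_trans (le_of_eq ?_) (mul_le_mul_of_nonneg_right hsqrt hA0.le)
    rw [hA, ← Real.rpow_add zero_lt_two]
    congr 1
    push_cast
    ring
  have hright : (2 : ℝ) ^ (-((n : ℝ) - 4 * L - 2)) = 4 * A := by
    rw [show -((n : ℝ) - 4 * L - 2) = 2 + -((n : ℝ) - 4 * L) by ring,
      Real.rpow_add zero_lt_two, ← hA]
    norm_num
  rw [hright, ← Finset.add_sum_Ioc_eq_sum_Icc (by omega : 2 ≤ n)]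
  change _ + ∑ m ∈ Finset.Icc 3 n, _ ≤ _
  linarith

/-- For all sufficiently large `n`,
`1 ≤ E_n ≤ 1 + Σ_{m=2}^{n} 2^{-m(n/2 - 3m/8 - 2 log₂ n)} ≤ 1 + 2^{-(n - 4 log₂ n - 2)}`. -/
theorem autAvg_bounds :
    ∃ N : ℕ, ∀ n ≥ N,
      1 ≤ autAvg n ∧
      autAvg n ≤ 1 + ∑ m ∈ Finset.Icc 2 n,
          (2 : ℝ) ^ (-(m : ℝ) * ((n : ℝ) / 2 - 3 * (m : ℝ) / 8 - 2 * Real.logb 2 n)) ∧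
      (1 + ∑ m ∈ Finset.Icc 2 n,
          (2 : ℝ) ^ (-(m : ℝ) * ((n : ℝ) / 2 - 3 * (m : ℝ) / 8 - 2 * Real.logb 2 n)))
        ≤ 1 + (2 : ℝ) ^ (-((n : ℝ) - 4 * Real.logb 2 n - 2)) := by
  obtain ⟨N, hN⟩ := Filter.eventually_atTop.1 eventually_logb_two_le
  refine ⟨max N 10, fun n hn => ?_⟩
  have hn10 : 10 ≤ n := (le_max_right _ _).trans hn
  exact ⟨one_le_autAvg n, autAvg_le (by omega),
    add_le_add_right (sum_two_rpow_le hn10 (hN n ((le_max_left _ _).trans hn))) 1⟩
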